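/- Let Z be a non-negative measurable stochastic process on ℝ with càdlàg paths, E[Z(t)] = 1 for all t, S = ∫_ℝ Z(t)dt ∈ (0,∞) a.s., and suppose the shift-invariance (tilting) identity E[Z(h)F(Z)] = E[Z(0)F(Z(·−h))] holds for all h ∈ ℝ and all measurable scale-invariant functionals F ≥ 0. Then for every T > 0 and x ≥ 0, ∫₀^∞ P(λ({t∈[0,T]: Z(t) > s}) > x) ds = ∫_ℝ ∫₀^∞ E[ (Z(0)/S)·1{λ({t∈[h, T+h]: Z(t) > s}) > x} ] ds dh. -/

import Mathlib

open MeasureTheory ENNReal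

open ProbabilityTheory Filter Topology in
theorem ae_tendsto_sum_gaussian_sample {g : ℝ → ℝ≥0∞} (hg : Measurable g)
    (hfin : ∀ t, g t ≠ ∞) (hint : ∫⁻ t, g t ≠ ∞) :
    ∀ᵐ u ∂Measure.infinitePi (fun _ : ℕ => gaussianReal 0 1),
      Tendsto (fun n : ℕ => (∑ i ∈ Finset.range n, g (u i) / gaussianPDF 0 1 (u i)) / n)
        atTop (𝓝 (∫⁻ t, g t)) := by
  have hpos : ∀ t, gaussianPDF 0 1 t ≠ 0 := fun t => (gaussianPDF_pos 0 one_ne_zero t).ne'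
  set k : ℝ → ℝ≥0∞ := fun t => g t / gaussianPDF 0 1 t with hk
  have hkm : Measurable k := hg.div (measurable_gaussianPDF 0 1)
  have hkfin : ∀ t, k t ≠ ∞ := fun t => ENNReal.div_ne_top (hfin t) (hpos t)
  have hkint : ∫⁻ t, k t ∂gaussianReal 0 1 = ∫⁻ t, g t := by
    rw [gaussianReal_of_var_ne_zero 0 one_ne_zero,
      lintegral_withDensity_eq_lintegral_mul _ (measurable_gaussianPDF 0 1) hkm]
    exact lintegral_congr fun t =>
      ENNReal.mul_div_cancel (hpos t) gaussianPDF_ne_top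
  have hmp := measurePreserving_eval_infinitePi (fun _ : ℕ => gaussianReal 0 1)
  have hintg : Integrable (fun t => (k t).toReal) (gaussianReal 0 1) :=
    integrable_toReal_of_lintegral_ne_top hkm.aemeasurable (by rwa [hkint])
  have hX := strong_law_ae_real (μ := Measure.infinitePi (fun _ : ℕ => gaussianReal 0 1))
    (fun i u => (k (u i)).toReal)
    ((hmp 0).integrable_comp_of_integrable hintg)
    (fun i j hij => (iIndepFun_infinitePi (P := fun _ : ℕ => gaussianReal 0 1)
      (X := fun _ t => (k t).toReal) (fun _ => hkm.ennreal_toReal)).indepFun hij)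
    (fun i => by
      refine IdentDistrib.comp (u := fun t => (k t).toReal)
        (f := fun u : ℕ → ℝ => u i) (g := fun u : ℕ → ℝ => u 0)
        ⟨(measurable_pi_apply i).aemeasurable, (measurable_pi_apply 0).aemeasurable, ?_⟩ hkm.ennreal_toReal
      exact (hmp i).map_eq.trans (hmp 0).map_eq.symm)
  have hmean : ∫ u, (k (u 0)).toReal ∂Measure.infinitePi (fun _ : ℕ => gaussianReal 0 1)
      = (∫⁻ t, g t).toReal := by
    rw [← hkint, ← integral_toReal hkm.aemeasurable
      (ae_of_all _ fun t => (hkfin t).lt_top)]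
    have h0 := integral_map (μ := Measure.infinitePi (fun _ : ℕ => gaussianReal 0 1))
      (measurable_pi_apply 0).aemeasurable
      (f := fun t => (k t).toReal) hkm.ennreal_toReal.aestronglyMeasurable
    exact h0.symm.trans (congrArg (fun ρ => ∫ t, (k t).toReal ∂ρ) (hmp 0).map_eq)
  rw [hmean] at hX
  filter_upwards [hX] with u hu
  have h2 := (ENNReal.continuous_ofReal.tendsto _).comp hu
  rw [ENNReal.ofReal_toReal hint] at h2
  refine h2.congr' ?_
  filter_upwards [eventually_gt_atTop 0] with n hn
  have hn' : (0 : ℝ) < n := by exact_mod_cast hn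
  simp only [Function.comp_apply]
  rw [ENNReal.ofReal_div_of_pos hn', ENNReal.ofReal_natCast,
    ENNReal.ofReal_sum_of_nonneg fun i _ => ENNReal.toReal_nonneg]
  simp_rw [ENNReal.ofReal_toReal (hkfin _)]
  rfl

open ProbabilityTheory Filter in
/-- Monte Carlo value of `∫⁻ t, g t` along the sample points `u`, with importance weights given by
the standard Gaussian density. Depends on `g` through countably many values only. -/
noncomputable def sampleLIntegral (u : ℕ → ℝ) (g : ℝ → ℝ≥0∞) : ℝ≥0∞ :=
  limsup (fun n : ℕ => (∑ i ∈ Finset.range n, g (u i) / gaussianPDF 0 1 (u i)) / n) atTop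

theorem sampleLIntegral_const_mul (u : ℕ → ℝ) (g : ℝ → ℝ≥0∞) {c : ℝ≥0∞} (hc : c ≠ ∞) :
    sampleLIntegral u (fun t => c * g t) = c * sampleLIntegral u g := by
  unfold sampleLIntegral
  rw [← ENNReal.limsup_const_mul_of_ne_top hc]
  simp_rw [mul_div_assoc, ← Finset.mul_sum, mul_div_assoc]

theorem measurable_sampleLIntegral {Y : Type*} [MeasurableSpace Y] (u : ℕ → ℝ)
    {G : Y → ℝ → ℝ≥0∞} (hG : ∀ t, Measurable fun y => G y t) :
    Measurable fun y => sampleLIntegral u (G y) := by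
  unfold sampleLIntegral
  refine Measurable.limsup fun n => Measurable.div_const ?_ _
  exact Finset.measurable_sum _ fun i _ => (hG _).div_const _

open ProbabilityTheory in
theorem ae_ae_sampleLIntegral_eq {Y : Type*} [MeasurableSpace Y] (κ : Measure Y) [SFinite κ]
    {G : Y → ℝ → ℝ≥0∞} (hG : Measurable (Function.uncurry G)) (hfin : ∀ y t, G y t ≠ ∞)
    (hint : ∀ᵐ y ∂κ, ∫⁻ t, G y t ≠ ∞) :
    ∀ᵐ u ∂Measure.infinitePi (fun _ : ℕ => gaussianReal 0 1),
      ∀ᵐ y ∂κ, sampleLIntegral u (G y) = ∫⁻ t, G y t := by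
  rw [← Measure.ae_ae_comm (p := fun y u => sampleLIntegral u (G y) = ∫⁻ t, G y t)]
  · filter_upwards [hint] with y hy
    filter_upwards [ae_tendsto_sum_gaussian_sample hG.of_uncurry_left (hfin y) hy] with u hu
    exact hu.limsup_eq
  · refine measurableSet_eq_fun ?_ (hG.lintegral_prod_right.comp measurable_fst)
    unfold sampleLIntegral
    refine Measurable.limsup fun n => Measurable.div_const ?_ _
    refine Finset.measurable_sum _ fun i _ => Measurable.div ?_ ?_
    · exact hG.comp (measurable_fst.prodMk ((measurable_pi_apply i).comp measurable_snd))
    · exact (measurable_gaussianPDF 0 1).comp ((measurable_pi_apply i).comp measurable_snd)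

/-- Indicator of `{t ∈ [0, T] | s < f t}`. -/
noncomputable def excursionIndicator (T s : ℝ) (f : ℝ → ℝ) (t : ℝ) : ℝ≥0∞ :=
  {t ∈ Set.Icc 0 T | s < f t}.indicator 1 t

theorem excursionIndicator_ne_top (T s : ℝ) (f : ℝ → ℝ) (t : ℝ) :
    excursionIndicator T s f t ≠ ∞ := by
  unfold excursionIndicator Set.indicator
  split_ifs <;> simp

theorem excursionIndicator_const_mul (T s : ℝ) (f : ℝ → ℝ) {c : ℝ} (hc : 0 < c) :
    excursionIndicator T s (fun t => c * f t) = excursionIndicator T (c⁻¹ * s) f := by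
  ext t
  simp only [excursionIndicator, inv_mul_lt_iff₀ hc]

theorem lintegral_excursionIndicator (T s : ℝ) {f : ℝ → ℝ} (hf : Measurable f) :
    ∫⁻ t, excursionIndicator T s f t = volume {t ∈ Set.Icc 0 T | s < f t} :=
  lintegral_indicator_one (measurableSet_Icc.inter (measurableSet_lt measurable_const hf))

theorem lintegral_excursionIndicator_ne_top (T s : ℝ) {f : ℝ → ℝ} (hf : Measurable f) :
    ∫⁻ t, excursionIndicator T s f t ≠ ∞ := by
  rw [lintegral_excursionIndicator T s hf]
  exact ((measure_mono (Set.sep_subset _ _)).trans_lt measure_Icc_lt_top).ne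

theorem measurable_excursionIndicator {Y : Type*} [MeasurableSpace Y] (T : ℝ) {s τ φ : Y → ℝ}
    {f : Y → ℝ → ℝ} (hs : Measurable s) (hτ : Measurable τ) (hφ : Measurable φ)
    (hf : ∀ y, f y (τ y) = φ y) :
    Measurable fun y => excursionIndicator T (s y) (f y) (τ y) := by
  have : (fun y => excursionIndicator T (s y) (f y) (τ y))
      = {y | τ y ∈ Set.Icc 0 T ∧ s y < φ y}.indicator 1 := by
    ext y
    simp only [excursionIndicator, Set.indicator, Set.mem_ofPred_eq, hf, Pi.one_apply]
  rw [this]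
  exact measurable_one.indicator ((hτ measurableSet_Icc).inter (measurableSet_lt hs hφ))

/-- Sampled version of `f ↦ λ {s > 0 | λ {t ∈ [0, T] | s < f t} > x}`. -/
noncomputable def sampleBerman (u : ℕ → ℝ) (T x : ℝ) (f : ℝ → ℝ) : ℝ≥0∞ :=
  ∫⁻ s in Set.Ioi (0 : ℝ),
    if ENNReal.ofReal x < sampleLIntegral u (excursionIndicator T s f) then 1 else 0

theorem measurable_sampleBerman (u : ℕ → ℝ) (T x : ℝ) : Measurable (sampleBerman u T x) := by
  refine Measurable.lintegral_prod_right' (f := fun p : (ℝ → ℝ) × ℝ =>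
    if ENNReal.ofReal x < sampleLIntegral u (excursionIndicator T p.2 p.1) then 1 else 0) ?_
  refine Measurable.ite (measurableSet_lt measurable_const ?_) measurable_const measurable_const
  exact measurable_sampleLIntegral u fun t => measurable_excursionIndicator T measurable_snd
    measurable_const ((measurable_pi_apply t).comp measurable_fst) fun _ => rfl

theorem sampleBerman_const_mul (u : ℕ → ℝ) (T x : ℝ) (f : ℝ → ℝ) {c : ℝ} (hc : 0 < c) :
    sampleBerman u T x (fun t => c * f t) = ENNReal.ofReal c * sampleBerman u T x f := by
  unfold sampleBerman
  simp_rw [excursionIndicator_const_mul T _ f hc]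
  rw [← lintegral_indicator measurableSet_Ioi, ← lintegral_indicator measurableSet_Ioi]
  set ψ : ℝ → ℝ≥0∞ := (Set.Ioi (0 : ℝ)).indicator fun s =>
    if ENNReal.ofReal x < sampleLIntegral u (excursionIndicator T s f) then 1 else 0 with hψ
  have h1 : ∀ s, (Set.Ioi (0 : ℝ)).indicator (fun s =>
      if ENNReal.ofReal x < sampleLIntegral u (excursionIndicator T (c⁻¹ * s) f)
        then (1 : ℝ≥0∞) else 0) s = ψ (c⁻¹ * s) := by
    intro s
    simp only [hψ, Set.indicator, Set.mem_Ioi, mul_pos_iff_of_pos_left (inv_pos.2 hc)]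
  have h2 := Real.map_volume_mul_left (inv_pos.2 hc).ne'
  rw [inv_inv, abs_of_pos hc] at h2
  rw [lintegral_congr h1, ← smul_eq_mul, ← lintegral_smul_measure, ← h2,
    (measurableEmbedding_mulLeft₀ (inv_pos.2 hc).ne').lintegral_map]

/-- The tilting identity, stated for functionals that are measurable on the product space, still
applies to the Berman functional divided by the total mass, though neither is product
measurable. -/
theorem tilt_berman {Ω : Type*} [MeasurableSpace Ω] (μ : Measure Ω) [IsProbabilityMeasure μ]
    (Z : Ω → ℝ → ℝ) (hmeas : Measurable (Function.uncurry Z))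
    (hS : ∀ᵐ ω ∂μ, ∫⁻ t, ENNReal.ofReal (Z ω t) ≠ ∞) (T x h : ℝ)
    (htilt : ∀ F : (ℝ → ℝ) → ℝ≥0∞, Measurable F →
      (∀ (f : ℝ → ℝ) (c : ℝ), 0 < c → F (fun t => c * f t) = F f) →
      ∫⁻ ω, ENNReal.ofReal (Z ω h) * F (Z ω) ∂μ
        = ∫⁻ ω, ENNReal.ofReal (Z ω 0) * F (fun t => Z ω (t - h)) ∂μ) :
    ∫⁻ ω, ENNReal.ofReal (Z ω h) *
        ((∫⁻ s in Set.Ioi (0 : ℝ), if ENNReal.ofReal x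
          < volume {t ∈ Set.Icc (0 : ℝ) T | s < Z ω t} then 1 else 0)
          / ∫⁻ t, ENNReal.ofReal (Z ω t)) ∂μ
      = ∫⁻ ω, ENNReal.ofReal (Z ω 0) *
        ((∫⁻ s in Set.Ioi (0 : ℝ), if ENNReal.ofReal x
          < volume {t ∈ Set.Icc (0 : ℝ) T | s < Z ω (t - h)} then 1 else 0)
          / ∫⁻ t, ENNReal.ofReal (Z ω t)) ∂μ := by
  have key : ∀ r : ℝ,
      ∀ᵐ u ∂Measure.infinitePi (fun _ : ℕ => ProbabilityTheory.gaussianReal 0 1), ∀ᵐ ω ∂μ,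
        sampleLIntegral u (fun t => ENNReal.ofReal (Z ω (t - r)))
            = ∫⁻ t, ENNReal.ofReal (Z ω t) ∧
        sampleBerman u T x (fun t => Z ω (t - r)) = ∫⁻ s in Set.Ioi (0 : ℝ),
          if ENNReal.ofReal x < volume {t ∈ Set.Icc (0 : ℝ) T | s < Z ω (t - r)}
            then 1 else 0 := by
    intro r
    have hZr : Measurable fun p : Ω × ℝ => Z p.1 (p.2 - r) :=
      hmeas.comp (measurable_fst.prodMk (measurable_snd.sub_const r))
    have hZω : ∀ ω, Measurable fun t => Z ω (t - r) := fun ω =>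
      hZr.comp measurable_prodMk_left
    have hshift : ∀ ω, ∫⁻ t, ENNReal.ofReal (Z ω (t - r)) = ∫⁻ t, ENNReal.ofReal (Z ω t) :=
      fun ω => lintegral_sub_right_eq_self (fun t => ENNReal.ofReal (Z ω t)) r
    have h1 := ae_ae_sampleLIntegral_eq μ (G := fun ω t => ENNReal.ofReal (Z ω (t - r)))
      hZr.ennreal_ofReal (fun _ _ => ENNReal.ofReal_ne_top)
      (by filter_upwards [hS] with ω hω; rwa [hshift])
    have h2 := ae_ae_sampleLIntegral_eq (μ.prod (volume.restrict (Set.Ioi (0 : ℝ))))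
      (G := fun p t => excursionIndicator T p.2 (fun t => Z p.1 (t - r)) t)
      (measurable_excursionIndicator T (Y := (Ω × ℝ) × ℝ) (s := fun q => q.1.2)
        (τ := fun q => q.2) (f := fun q t => Z q.1.1 (t - r))
        (by fun_prop) (by fun_prop)
        (hZr.comp ((measurable_fst.comp measurable_fst).prodMk measurable_snd)) fun _ => rfl)
      (fun _ _ => excursionIndicator_ne_top _ _ _ _)
      (ae_of_all _ fun p => lintegral_excursionIndicator_ne_top _ _ (hZω p.1))
    filter_upwards [h1, h2] with u hu1 hu2
    filter_upwards [hu1, Measure.ae_ae_of_ae_prod hu2] with ω hω1 hω2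
    refine ⟨hω1.trans (hshift ω), lintegral_congr_ae ?_⟩
    filter_upwards [hω2] with s hs
    rw [hs, lintegral_excursionIndicator T s (hZω ω)]
  obtain ⟨u, hu0, huh⟩ := ((key 0).and (key h)).exists
  have hF := htilt
    (fun f => sampleBerman u T x f / sampleLIntegral u fun t => ENNReal.ofReal (f t))
    ((measurable_sampleBerman u T x).div
      (measurable_sampleLIntegral u fun t => (measurable_pi_apply t).ennreal_ofReal))
    (fun f c hc => by
      simp_rw [ENNReal.ofReal_mul hc.le]
      rw [sampleBerman_const_mul u T x f hc, sampleLIntegral_const_mul u _ ENNReal.ofReal_ne_top,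
        ENNReal.mul_div_mul_left _ _ (ENNReal.ofReal_pos.2 hc).ne' ENNReal.ofReal_ne_top])
  simp only [sub_zero] at hu0
  refine Eq.trans (lintegral_congr_ae ?_) (hF.trans (lintegral_congr_ae ?_))
  · filter_upwards [hu0] with ω hω
    rw [hω.1, hω.2]
  · filter_upwards [huh] with ω hω
    rw [hω.1, hω.2]

/-- From the tilting identity for the spectral process `Z`, the Berman
functional over `[0,T]` equals the averaged tilted representation:
`∫₀^∞ P(λ{t∈[0,T]: Z(t)>s} > x) ds
  = ∫_ℝ ∫₀^∞ E[(Z(0)/S)·1{λ{t∈[h,T+h]: Z(t)>s} > x}] ds dh`. -/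
theorem stmt17 {Ω : Type*} [MeasurableSpace Ω] (μ : Measure Ω) [IsProbabilityMeasure μ]
    (Z : Ω → ℝ → ℝ) (hmeas : Measurable (Function.uncurry Z))
    (hnn : ∀ᵐ ω ∂μ, ∀ t, 0 ≤ Z ω t)
    (hmean : ∀ t : ℝ, ∫ ω, Z ω t ∂μ = 1)
    (hS : ∀ᵐ ω ∂μ, (0 < ∫ t, Z ω t) ∧ Integrable (Z ω))
    (htilt : ∀ h : ℝ, ∀ F : (ℝ → ℝ) → ℝ≥0∞, Measurable F →
      (∀ (f : ℝ → ℝ) (c : ℝ), 0 < c → F (fun t => c * f t) = F f) →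
      ∫⁻ ω, ENNReal.ofReal (Z ω h) * F (Z ω) ∂μ
        = ∫⁻ ω, ENNReal.ofReal (Z ω 0) * F (fun t => Z ω (t - h)) ∂μ)
    (T x : ℝ) (hT : 0 < T) (hx : 0 ≤ x) :
    ∫⁻ s in Set.Ioi (0 : ℝ),
        μ {ω | ENNReal.ofReal x < volume {t ∈ Set.Icc (0 : ℝ) T | s < Z ω t}}
      = ∫⁻ h : ℝ, ∫⁻ s in Set.Ioi (0 : ℝ),
          ∫⁻ ω, ENNReal.ofReal (Z ω 0 / ∫ t, Z ω t) *
            (if ENNReal.ofReal x < volume {t ∈ Set.Icc h (T + h) | s < Z ω t}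
              then 1 else 0) ∂μ := by
  have hsum : ∀ᵐ ω ∂μ, ENNReal.ofReal (∫ t, Z ω t) = ∫⁻ t, ENNReal.ofReal (Z ω t) := by
    filter_upwards [hnn, hS] with ω h0 h1
    exact ofReal_integral_eq_lintegral_ofReal h1.2 (ae_of_all _ h0)
  have hfin : ∀ᵐ ω ∂μ, ∫⁻ t, ENNReal.ofReal (Z ω t) ≠ ∞ := by
    filter_upwards [hsum] with ω h1
    exact h1 ▸ ENNReal.ofReal_ne_top
  have hpos : ∀ᵐ ω ∂μ, ∫⁻ t, ENNReal.ofReal (Z ω t) ≠ 0 := by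
    filter_upwards [hsum, hS] with ω h1 h2
    exact h1 ▸ (ENNReal.ofReal_pos.2 h2.1).ne'
  have hvol : ∀ h : ℝ, Measurable fun p : Ω × ℝ =>
      volume {t ∈ Set.Icc h (T + h) | p.2 < Z p.1 t} := by
    intro h
    refine measurable_measure_prodMk_left
      (s := {q : (Ω × ℝ) × ℝ | q.2 ∈ Set.Icc h (T + h) ∧ q.1.2 < Z q.1.1 q.2}) ?_
    exact (measurable_snd measurableSet_Icc).inter (measurableSet_lt
      (measurable_snd.comp measurable_fst)
      (hmeas.comp ((measurable_fst.comp measurable_fst).prodMk measurable_snd)))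
  have hind : ∀ h : ℝ, Measurable fun p : Ω × ℝ =>
      if ENNReal.ofReal x < volume {t ∈ Set.Icc h (T + h) | p.2 < Z p.1 t}
        then (1 : ℝ≥0∞) else 0 := fun h =>
    Measurable.ite (measurableSet_lt measurable_const (hvol h)) measurable_const measurable_const
  have hind0 := hind 0
  simp only [add_zero] at hind0
  have hSm : Measurable fun ω => ∫⁻ t, ENNReal.ofReal (Z ω t) :=
    Measurable.lintegral_prod_right hmeas.ennreal_ofReal
  have hNm : Measurable fun ω => ∫⁻ s in Set.Ioi (0 : ℝ),
      if ENNReal.ofReal x < volume {t ∈ Set.Icc (0 : ℝ) T | s < Z ω t}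
        then (1 : ℝ≥0∞) else 0 :=
    Measurable.lintegral_prod_right hind0
  have hZ0 : Measurable fun ω => Z ω 0 := hmeas.comp measurable_prodMk_right
  calc
    _ = ∫⁻ s in Set.Ioi (0 : ℝ), ∫⁻ ω : Ω,
          (if ENNReal.ofReal x < volume {t ∈ Set.Icc (0 : ℝ) T | s < Z ω t}
            then 1 else 0) ∂μ := by
        refine lintegral_congr fun s => ?_
        have hm : MeasurableSet
            {ω | ENNReal.ofReal x < volume {t ∈ Set.Icc (0 : ℝ) T | s < Z ω t}} := by
          have := (hvol 0).comp (measurable_prodMk_right (y := s))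
          simp only [add_zero] at this
          exact measurableSet_lt measurable_const this
        rw [← lintegral_indicator_one hm]
        simp only [Set.indicator, Set.mem_ofPred_eq, Pi.one_apply]
    _ = ∫⁻ ω : Ω, ∫⁻ s in Set.Ioi (0 : ℝ),
          (if ENNReal.ofReal x < volume {t ∈ Set.Icc (0 : ℝ) T | s < Z ω t}
            then 1 else 0) ∂volume ∂μ :=
        (lintegral_lintegral_swap hind0.aemeasurable).symm
    _ = ∫⁻ ω : Ω, ∫⁻ h, ENNReal.ofReal (Z ω h) * ((∫⁻ s in Set.Ioi (0 : ℝ),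
          (if ENNReal.ofReal x < volume {t ∈ Set.Icc (0 : ℝ) T | s < Z ω t}
            then 1 else 0)) / ∫⁻ t, ENNReal.ofReal (Z ω t)) ∂volume ∂μ := by
        refine lintegral_congr_ae ?_
        filter_upwards [hfin, hpos] with ω h1 h2
        rw [lintegral_mul_const _ hmeas.of_uncurry_left.ennreal_ofReal,
          ENNReal.mul_div_cancel h2 h1]
    _ = ∫⁻ h : ℝ, ∫⁻ ω : Ω, ENNReal.ofReal (Z ω h) * ((∫⁻ s in Set.Ioi (0 : ℝ),
          (if ENNReal.ofReal x < volume {t ∈ Set.Icc (0 : ℝ) T | s < Z ω t}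
            then 1 else 0)) / ∫⁻ t, ENNReal.ofReal (Z ω t)) ∂μ :=
        lintegral_lintegral_swap
          (hmeas.ennreal_ofReal.mul ((hNm.div hSm).comp measurable_fst)).aemeasurable
    _ = ∫⁻ h : ℝ, ∫⁻ ω : Ω, ENNReal.ofReal (Z ω 0) * ((∫⁻ s in Set.Ioi (0 : ℝ),
          (if ENNReal.ofReal x < volume {t ∈ Set.Icc (0 : ℝ) T | s < Z ω (t - h)}
            then 1 else 0)) / ∫⁻ t, ENNReal.ofReal (Z ω t)) ∂μ :=
        lintegral_congr fun h => tilt_berman μ Z hmeas hfin T x h (htilt h)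
    _ = ∫⁻ h : ℝ, ∫⁻ ω : Ω, ENNReal.ofReal (Z ω 0) * ((∫⁻ s in Set.Ioi (0 : ℝ),
          (if ENNReal.ofReal x < volume {t ∈ Set.Icc (0 : ℝ) T | s < Z ω (t - -h)}
            then 1 else 0)) / ∫⁻ t, ENNReal.ofReal (Z ω t)) ∂μ :=
        (lintegral_neg_eq_self _).symm
    _ = _ := by
        refine lintegral_congr fun h => ?_
        have hshift : ∀ ω s, volume {t ∈ Set.Icc (0 : ℝ) T | s < Z ω (t - -h)}
            = volume {t ∈ Set.Icc h (T + h) | s < Z ω t} := by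
          intro ω s
          rw [← measure_preimage_add_right volume h {t ∈ Set.Icc h (T + h) | s < Z ω t}]
          congr 1
          ext t
          simp
        simp_rw [hshift]
        have hdens : ∀ᵐ ω ∂μ, ENNReal.ofReal (Z ω 0 / ∫ t, Z ω t)
            = ENNReal.ofReal (Z ω 0) / ∫⁻ t, ENNReal.ofReal (Z ω t) := by
          filter_upwards [hsum, hS] with ω h1 h2
          rw [ENNReal.ofReal_div_of_pos h2.1, h1]
        have hswap := lintegral_lintegral_swap (μ := μ)
          (ν := volume.restrict (Set.Ioi (0 : ℝ)))
          (f := fun ω s => (ENNReal.ofReal (Z ω 0) / ∫⁻ t, ENNReal.ofReal (Z ω t)) *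
            if ENNReal.ofReal x < volume {t ∈ Set.Icc h (T + h) | s < Z ω t} then 1 else 0)
          (((hZ0.ennreal_ofReal.div hSm).comp measurable_fst).mul (hind h)).aemeasurable
        refine Eq.trans (lintegral_congr fun ω => ?_)
          (hswap.trans (lintegral_congr fun s => lintegral_congr_ae ?_))
        · have hm := (hind h).comp (measurable_prodMk_left (x := ω))
          refine Eq.trans ?_ (lintegral_const_mul _ hm).symm
          simp only [div_eq_mul_inv, Function.comp_apply]
          ring
        · filter_upwards [hdens] with ω h1
          rw [h1]
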